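/- Let a8,a7 ∈ F_q^× and b3,b4 ∈ F_q. (a) Define λ on K = {0}×V by λ(t3,t5,t6,t7,t8,t9) = φ(a7·t7 + a8·t8). Then λ^H(x(t)) = q^3·φ(a7·t7 + a8·t8) if t1 = t2 = t3 = t4 = t5 = t6 = 0, and 0 otherwise. (b) Let W = {x(t) : t1 = t5 = 0} and μ(x(t)) = φ(a8·t8); set χ(x(t)) = φ(b3·t3 + b4·t4)·μ^H(x(t)). If t3 = 0 then χ(x(t)) = q^2·φ(b4·t4 + a8·t8) when t1 = t2 = t5 = t6 = 0, and 0 otherwise; if t3 ≠ 0 then χ(x(t)) = q·φ(b3·t3 + b4·t4 + a8·(t8 − t5·t6/t3)) when t1 = t2 = 0, and 0 otherwise. -/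

import Mathlib

open Finset
open scoped Classical

noncomputable section

/-- The additive character `φ(x) = exp(2πi·Tr(x)/p)` of `F_q`, where `Tr` is the trace to `F_p`. -/
def phi (p : ℕ) (F : Type) [Field F] [Fintype F] [Algebra (ZMod p) F] (x : F) : ℂ :=
  Complex.exp (2 * Real.pi * Complex.I * ((Algebra.trace (ZMod p) F x).val : ℂ) / (p : ℂ))

namespace UM10

variable (F : Type) [Field F] [Fintype F]

/- `V = F_q^6` has coordinates `(t3,t5,t6,t7,t8,t9)`, indexed `0,…,5`. -/

/-- `σ1(s) : t5 ↦ t5 − s·t3, t8 ↦ t8 − s·t6, t9 ↦ t9 − s·t7`. -/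
def sig1 (s : F) (v : Fin 6 → F) : Fin 6 → F :=
  ![v 0, v 1 - s * v 0, v 2, v 3, v 4 - s * v 2, v 5 - s * v 3]

/-- `σ2(s) : t6 ↦ t6 − s·t3, t8 ↦ t8 − s·t5`. -/
def sig2 (s : F) (v : Fin 6 → F) : Fin 6 → F :=
  ![v 0, v 1, v 2 - s * v 0, v 3, v 4 - s * v 1, v 5]

/-- `σ4(s) : t7 ↦ t7 − s·t3, t9 ↦ t9 − s·t5`. -/
def sig4 (s : F) (v : Fin 6 → F) : Fin 6 → F :=
  ![v 0, v 1, v 2, v 3 - s * v 0, v 4, v 5 - s * v 1]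

/-- The composite action `σ1(s1)σ2(s2)σ4(s4)` of `F_q^3` on `V`. -/
def sigma (s : Fin 3 → F) (v : Fin 6 → F) : Fin 6 → F :=
  sig1 F (s 0) (sig2 F (s 1) (sig4 F (s 2) v))

/-- Multiplication in the semidirect product `H = F_q^3 ⋉ V`:
conjugating `(0,v)` by `(s,0)` yields `(0, σ1(s1)σ2(s2)σ4(s4)(v))`. -/
def Hmul (x y : (Fin 3 → F) × (Fin 6 → F)) : (Fin 3 → F) × (Fin 6 → F) :=
  (x.1 + y.1, sigma F y.1 x.2 + y.2)

/-- Inversion in `H`. -/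
def Hinv (x : (Fin 3 → F) × (Fin 6 → F)) : (Fin 3 → F) × (Fin 6 → F) :=
  (-x.1, -(sigma F (-x.1) x.2))

/-- Conjugation `x⁻¹ h x` in `H`. -/
def Hconj (x h : (Fin 3 → F) × (Fin 6 → F)) : (Fin 3 → F) × (Fin 6 → F) :=
  Hmul F (Hmul F (Hinv F x) h) x

/-- The element `x(t) = (0,(t3,0,…,0))·((t1,t2,t4),0)·(0,(0,t5,t6,t7,t8,t9))` of `H`,
for `t = (t1,…,t9)` (indexed `0,…,8`). -/
def xelt (t : Fin 9 → F) : (Fin 3 → F) × (Fin 6 → F) :=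
  Hmul F (Hmul F ((0 : Fin 3 → F), ![t 2, 0, 0, 0, 0, 0]) (![t 0, t 1, t 3], (0 : Fin 6 → F)))
    ((0 : Fin 3 → F), ![0, t 4, t 5, t 6, t 7, t 8])

/-- The extension by zero to `H` of a function on a subset `K` of `H`. -/
def dotExt (K : Set ((Fin 3 → F) × (Fin 6 → F))) (lam : (Fin 3 → F) × (Fin 6 → F) → ℂ)
    (h : (Fin 3 → F) × (Fin 6 → F)) : ℂ :=
  if h ∈ K then lam h else 0

/-- The induced class function `λ^H(h) = (1/|K|) ∑_{x∈H} λ̇(x⁻¹ h x)`, for `λ` defined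
on a subgroup `K` of order `cardK`. -/
def ind (cardK : ℕ) (K : Set ((Fin 3 → F) × (Fin 6 → F)))
    (lam : (Fin 3 → F) × (Fin 6 → F) → ℂ) (h : (Fin 3 → F) × (Fin 6 → F)) : ℂ :=
  (1 / (cardK : ℂ)) * ∑ x : (Fin 3 → F) × (Fin 6 → F), dotExt F K lam (Hconj F x h)

end UM10
/-- `phi` as an additive character. -/
def phiChar (p : ℕ) [Fact p.Prime] (F : Type) [Field F] [Algebra (ZMod p) F] : AddChar F ℂ :=
  (ZMod.stdAddChar (N := p)).compAddMonoidHom (Algebra.trace (ZMod p) F).toAddMonoidHom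

section Character

variable (p : ℕ) [Fact p.Prime] (F : Type) [Field F] [Fintype F] [Algebra (ZMod p) F]

theorem phiChar_apply (x : F) : phiChar p F x = phi p F x := by
  simp [phiChar, phi, ZMod.stdAddChar_apply, ZMod.toCircle_apply]

theorem phiChar_isPrimitive [CharP F p] : (phiChar p F).IsPrimitive := by
  refine AddChar.IsPrimitive.of_ne_one ((AddChar.ne_one_iff).2 ?_)
  obtain ⟨x, hx⟩ := Algebra.trace_surjective (ZMod p) F 1
  refine ⟨x, fun h => one_ne_zero (α := ZMod p) (ZMod.injective_stdAddChar ?_)⟩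
  have h1 : ZMod.stdAddChar (Algebra.trace (ZMod p) F x) = 1 := h
  rw [hx] at h1
  rw [h1, AddChar.map_zero_eq_one]

theorem phi_add (x y : F) : phi p F (x + y) = phi p F x * phi p F y := by
  simp only [← phiChar_apply, AddChar.map_add_eq_mul]

theorem sum_phi_add_mul [CharP F p] (a b : F) :
    ∑ x : F, phi p F (a + x * b) = if b = 0 then (Fintype.card F : ℂ) * phi p F a else 0 := by
  simp only [phi_add, ← Finset.mul_sum]
  have h := AddChar.sum_mulShift (ψ := phiChar p F) b (phiChar_isPrimitive p F)
  simp only [phiChar_apply] at h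
  rw [h]
  split_ifs <;> simp [mul_comm]

end Character

theorem sum_fin_three_arrow {α M : Type*} [Fintype α] [AddCommMonoid M] (f : α → α → α → M) :
    ∑ r : Fin 3 → α, f (r 0) (r 1) (r 2) = ∑ x, ∑ y, ∑ z, f x y z := by
  simp only [← Fintype.sum_prod_type']
  let e : (Fin 3 → α) ≃ α × α × α :=
    { toFun := fun r => (r 0, r 1, r 2)
      invFun := fun x => ![x.1, x.2.1, x.2.2]
      left_inv := fun r => by ext i; fin_cases i <;> rfl
      right_inv := fun x => rfl }
  exact Fintype.sum_equiv e (fun r => f (r 0) (r 1) (r 2)) (fun x => f x.1 x.2.1 x.2.2)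
    (fun r => rfl)

theorem sum_arrow_apply {ι α M : Type*} [Fintype ι] [DecidableEq ι] [Fintype α] [AddCommMonoid M]
    (i : ι) (f : α → M) :
    ∑ w : ι → α, f (w i) = Fintype.card α ^ (Fintype.card ι - 1) • ∑ x, f x := by
  rw [Fintype.sum_equiv (Equiv.funSplitAt i α) (fun w => f (w i)) (fun x => f x.1)
    (fun w => rfl), Fintype.sum_prod_type]
  simp [← Finset.smul_sum, Fintype.card_subtype_compl]

namespace UM10

variable (F : Type) [Field F]

theorem sigma_apply (s : Fin 3 → F) (v : Fin 6 → F) :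
    sigma F s v = ![v 0, v 1 - s 0 * v 0, v 2 - s 1 * v 0, v 3 - s 2 * v 0,
      v 4 - s 1 * v 1 - s 0 * (v 2 - s 1 * v 0),
      v 5 - s 2 * v 1 - s 0 * (v 3 - s 2 * v 0)] := by
  simp [sigma, sig1, sig2, sig4]

theorem Hconj_xelt (x : (Fin 3 → F) × (Fin 6 → F)) (t : Fin 9 → F) :
    (Hconj F x (xelt F t)).1 = ![t 0, t 1, t 3] ∧
    (Hconj F x (xelt F t)).2 1 = t 4 - (t 0 + x.1 0) * t 2 + t 0 * x.2 0 ∧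
    (t 0 = 0 → (Hconj F x (xelt F t)).2 3 = t 6 - (t 3 + x.1 2) * t 2 + t 3 * x.2 0) ∧
    (t 0 = 0 → (Hconj F x (xelt F t)).2 4 =
      t 7 - x.1 1 * t 4 - x.1 0 * (t 5 - (t 1 + x.1 1) * t 2) + t 1 * x.2 1) := by
  refine ⟨?_, ?_, fun h => ?_, fun h => ?_⟩
  · simp [Hconj, xelt, Hmul, Hinv]
  all_goals
    simp [Hconj, xelt, Hmul, Hinv, sigma_apply, Matrix.vecHead, Matrix.vecTail, *]
    ring

end UM10

open UM10 in
/-- the values of the characters in the family `F_8`: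
(a) `λ^H` for `λ(t3,t5,t6,t7,t8,t9) = φ(a7·t7 + a8·t8)` on `K = {0}×V`;
(b) `χ(x(t)) = φ(b3·t3 + b4·t4)·μ^H(x(t))` for `μ(x(t)) = φ(a8·t8)` on
`W = {x(t) : t1 = t5 = 0}`. -/
theorem stmt7 (p : ℕ) [Fact p.Prime] (F : Type) [Field F] [Fintype F] [CharP F p]
    [Algebra (ZMod p) F] (a8 a7 : F) (h8 : a8 ≠ 0) (h7 : a7 ≠ 0) (b3 b4 : F) :
    (∀ t : Fin 9 → F,
      ind F ((Fintype.card F) ^ 6) {h | h.1 = 0}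
          (fun h => phi p F (a7 * h.2 3 + a8 * h.2 4)) (xelt F t) =
        if t 0 = 0 ∧ t 1 = 0 ∧ t 2 = 0 ∧ t 3 = 0 ∧ t 4 = 0 ∧ t 5 = 0 then
          (Fintype.card F : ℂ) ^ 3 * phi p F (a7 * t 6 + a8 * t 7)
        else 0) ∧
    (∀ t : Fin 9 → F,
      phi p F (b3 * t 2 + b4 * t 3) *
        ind F ((Fintype.card F) ^ 7) {h | h.1 0 = 0 ∧ h.2 1 = 0}
          (fun h => phi p F (a8 * h.2 4)) (xelt F t) =
      if t 2 = 0 then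
        (if t 0 = 0 ∧ t 1 = 0 ∧ t 4 = 0 ∧ t 5 = 0 then
          (Fintype.card F : ℂ) ^ 2 * phi p F (b4 * t 3 + a8 * t 7)
        else 0)
      else
        (if t 0 = 0 ∧ t 1 = 0 then
          (Fintype.card F : ℂ) *
            phi p F (b3 * t 2 + b4 * t 3 + a8 * (t 7 - t 4 * t 5 / t 2))
        else 0)) := by
  have hq : (Fintype.card F : ℂ) ≠ 0 := Nat.cast_ne_zero.2 Fintype.card_ne_zero
  refine ⟨fun t => ?_, fun t => ?_⟩
  · by_cases ht : t 0 = 0 ∧ t 1 = 0 ∧ t 3 = 0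
    · obtain ⟨h0, h1, h3⟩ := ht
      have key (x : (Fin 3 → F) × (Fin 6 → F)) :
          dotExt F {h | h.1 = 0} (fun h => phi p F (a7 * h.2 3 + a8 * h.2 4))
            (Hconj F x (xelt F t)) =
          phi p F (a7 * t 6 + a8 * (t 7 - x.1 1 * t 4 - x.1 0 * (t 5 - x.1 1 * t 2)) +
            x.1 2 * (-(a7 * t 2))) := by
        obtain ⟨e1, -, e3, e4⟩ := Hconj_xelt F x t
        rw [dotExt, if_pos (by simp [e1, h0, h1, h3]), e3 h0, e4 h0, h1, h3]
        ring_nf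
      have sum_eq : ∑ r : Fin 3 → F,
          phi p F (a7 * t 6 + a8 * (t 7 - r 1 * t 4 - r 0 * (t 5 - r 1 * t 2)) +
            r 2 * (-(a7 * t 2))) =
          if t 2 = 0 ∧ t 4 = 0 ∧ t 5 = 0 then
            (Fintype.card F : ℂ) ^ 3 * phi p F (a7 * t 6 + a8 * t 7) else 0 := by
        rw [sum_fin_three_arrow (fun x y z => phi p F (a7 * t 6 +
          a8 * (t 7 - y * t 4 - x * (t 5 - y * t 2)) + z * (-(a7 * t 2))))]
        simp only [sum_phi_add_mul]
        by_cases h2 : t 2 = 0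
        · have e (x y : F) : a7 * t 6 + a8 * (t 7 - y * t 4 - x * (t 5 - y * t 2)) =
              (a7 * t 6 + a8 * t 7 + x * (-(a8 * t 5))) + y * (-(a8 * t 4)) := by
            rw [h2]; ring
          simp only [if_pos (show -(a7 * t 2) = 0 by simp [h2]), e, ← Finset.mul_sum,
            sum_phi_add_mul]
          by_cases h4 : t 4 = 0
          · simp only [if_pos (show -(a8 * t 4) = 0 by simp [h4]), ← Finset.mul_sum,
              sum_phi_add_mul]
            by_cases h5 : t 5 = 0
            · simp [h2, h4, h5]
              ring
            · simp [h2, h5, h8]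
          · simp [h2, h4, h8]
        · simp [h2, h7]
      simp only [ind, key, Fintype.sum_prod_type, Finset.sum_const, ← Finset.smul_sum, sum_eq]
      simp [h0, h1, h3, hq]
    · have key (x : (Fin 3 → F) × (Fin 6 → F)) :
          dotExt F {h | h.1 = 0} (fun h => phi p F (a7 * h.2 3 + a8 * h.2 4))
            (Hconj F x (xelt F t)) = 0 := by
        rw [dotExt, if_neg]
        rw [Set.mem_ofPred_eq, (Hconj_xelt F x t).1]
        simpa using ht
      rw [if_neg (by tauto)]
      simp [ind, key]
  · by_cases h0 : t 0 = 0
    · have key (x : (Fin 3 → F) × (Fin 6 → F)) :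
          dotExt F {h | h.1 0 = 0 ∧ h.2 1 = 0} (fun h => phi p F (a8 * h.2 4))
            (Hconj F x (xelt F t)) =
          if t 4 = x.1 0 * t 2 then
            phi p F (a8 * (t 7 - x.1 0 * (t 5 - t 1 * t 2)) + x.2 1 * (a8 * t 1)) else 0 := by
        obtain ⟨e1, e2, -, e4⟩ := Hconj_xelt F x t
        have hmem : Hconj F x (xelt F t) ∈
            {h : (Fin 3 → F) × (Fin 6 → F) | h.1 0 = 0 ∧ h.2 1 = 0} ↔ t 4 = x.1 0 * t 2 := by
          simp [e1, e2, h0, sub_eq_zero]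
        by_cases h : t 4 = x.1 0 * t 2
        · rw [dotExt, if_pos (hmem.2 h), if_pos h, e4 h0, h]
          ring_nf
        · rw [dotExt, if_neg (mt hmem.1 h), if_neg h]
      have sum_w (r : Fin 3 → F) : ∑ w : Fin 6 → F, (if t 4 = r 0 * t 2 then
            phi p F (a8 * (t 7 - r 0 * (t 5 - t 1 * t 2)) + w 1 * (a8 * t 1)) else 0) =
          if t 1 = 0 then (Fintype.card F : ℂ) ^ 6 *
            (if t 4 = r 0 * t 2 then phi p F (a8 * t 7 + r 0 * (-(a8 * t 5))) else 0) else 0 := by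
        rw [sum_arrow_apply 1 (fun y => if t 4 = r 0 * t 2 then
            phi p F (a8 * (t 7 - r 0 * (t 5 - t 1 * t 2)) + y * (a8 * t 1)) else 0)]
        by_cases h : t 4 = r 0 * t 2
        · simp only [if_pos h, sum_phi_add_mul]
          by_cases h1 : t 1 = 0
          · simp only [h1, mul_zero, if_true, Fintype.card_fin, nsmul_eq_mul]
            push_cast
            ring_nf
          · simp [h1, h8]
        · simp [h]
      simp only [ind, key, Fintype.sum_prod_type, sum_w]
      by_cases h1 : t 1 = 0
      · simp only [h1, if_true, ← Finset.mul_sum]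
        rw [sum_arrow_apply 0 (fun y => if t 4 = y * t 2 then
          phi p F (a8 * t 7 + y * (-(a8 * t 5))) else 0)]
        by_cases h2 : t 2 = 0
        · by_cases h4 : t 4 = 0
          · simp only [h2, h4, mul_zero, if_true, sum_phi_add_mul]
            by_cases h5 : t 5 = 0
            · simp [h0, h5, phi_add]
              field_simp
            · simp [h5, h8]
          · simp [h2, h4]
        · have e (y : F) : (t 4 = y * t 2) ↔ (y = t 4 / t 2) := by
            rw [eq_div_iff h2, eq_comm]
          simp only [e, Finset.sum_ite_eq', Finset.mem_univ, if_true, if_neg h2]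
          have e' : a8 * (t 7 - t 4 * t 5 / t 2) = a8 * t 7 + t 4 / t 2 * (-(a8 * t 5)) := by
            ring
          simp [h0, e', phi_add]
          field_simp
      · simp [h1]
    · have key (x : (Fin 3 → F) × (Fin 6 → F)) :
          dotExt F {h | h.1 0 = 0 ∧ h.2 1 = 0} (fun h => phi p F (a8 * h.2 4))
            (Hconj F x (xelt F t)) = 0 := by
        rw [dotExt, if_neg]
        rw [Set.mem_ofPred_eq, (Hconj_xelt F x t).1]
        simp [h0]
      simp [ind, key, h0]
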